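/- Let B be a finite set of odd cardinality n ≥ 5, A = Alt(B) ⊆ Aut(Q_B) acting on Q_B, and let R ⊆ End_{F₂}(Q_B) be a subalgebra containing Id such that uRu⁻¹ ⊆ R for all u ∈ A. Then either R = F₂·Id or R = End_{F₂}(Q_B). -/

import Mathlib

/-- The F₂-vector space of even-cardinality subsets of `B`. -/
def QB (B : Type*) [Fintype B] : Submodule (ZMod 2) (B → ZMod 2) :=
  LinearMap.ker (∑ x : B, LinearMap.proj x)

/-- The linear action of a permutation `s` of `B` on `F₂^B`. -/
def permMap {B : Type*} (s : Equiv.Perm B) :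
    (B → ZMod 2) →ₗ[ZMod 2] (B → ZMod 2) where
  toFun φ := fun x => φ (s.symm x)
  map_add' _ _ := rfl
  map_smul' _ _ := rfl

theorem permMap_mem_QB {B : Type*} [Fintype B] (s : Equiv.Perm B) :
    ∀ x ∈ QB B, permMap s x ∈ QB B := by
  intro φ hφ
  simp only [QB, LinearMap.mem_ker, LinearMap.sum_apply, LinearMap.proj_apply,
    permMap, LinearMap.coe_mk, AddHom.coe_mk] at *
  rw [Equiv.sum_comp s.symm φ]
  exact hφ

/-- The induced action of a permutation on `Q_B`. -/
def permQB {B : Type*} [Fintype B] (s : Equiv.Perm B) :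
    Module.End (ZMod 2) (QB B) :=
  (permMap s).restrict (permMap_mem_QB s)

open Matrix

/-- The matrix of the identity of `Q_B`. -/
def Em (B : Type*) [DecidableEq B] : Matrix B B (ZMod 2) := fun i j => if i = j then 0 else 1

/-- Abstract properties of the set of matrices representing `R`. -/
structure Good {B : Type*} [Fintype B] [DecidableEq B] (S : Set (Matrix B B (ZMod 2))) : Prop where
  add : ∀ X ∈ S, ∀ Y ∈ S, X + Y ∈ S
  mul : ∀ X ∈ S, ∀ Y ∈ S, X * Y ∈ S
  conj : ∀ s : Equiv.Perm B, Equiv.Perm.sign s = 1 → ∀ X ∈ S, X.submatrix s s ∈ S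
  one : Em B ∈ S
  row : ∀ X ∈ S, ∀ i, ∑ j, X i j = 0
  col : ∀ X ∈ S, ∀ j, ∑ i, X i j = 0

/-- The two-element set. -/
def dd {B : Type*} [DecidableEq B] (a b : B) : B → ZMod 2 := fun i => if i = a ∨ i = b then 1 else 0

theorem dd_dot {B : Type*} [Fintype B] [DecidableEq B] (a b : B) (h : a ≠ b) (v : B → ZMod 2) :
    dd a b ⬝ᵥ v = v a + v b := by
  have : dd a b = Pi.single a 1 + Pi.single b 1 := by
    funext i
    simp only [dd, Pi.add_apply, Pi.single_apply]
    grind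
  rw [this, add_dotProduct]
  simp

theorem z2 (x : ZMod 2) : x = 0 ∨ x = 1 := by
  revert x; decide

theorem fullconj {B : Type*} [Fintype B] [DecidableEq B] {S : Set (Matrix B B (ZMod 2))}
    (hS : Good S) (X : Matrix B B (ZMod 2)) (hX : X ∈ S) (a b : B) (hab : a ≠ b)
    (hfix : X.submatrix (Equiv.swap a b) (Equiv.swap a b) = X) (s : Equiv.Perm B) :
    X.submatrix s s ∈ S := by
  rcases Int.units_eq_one_or (Equiv.Perm.sign s) with h | h
  · exact hS.conj s h X hX
  · have := hS.conj (Equiv.swap a b * s) (by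
      rw [Equiv.Perm.sign_mul, h, Equiv.Perm.sign_swap hab]; rfl) X hX
    have e : X.submatrix (Equiv.swap a b * s) (Equiv.swap a b * s)
      = (X.submatrix (Equiv.swap a b) (Equiv.swap a b)).submatrix s s := by
      ext i j; simp
    rw [e, hfix] at this
    exact this

theorem exists_perm4 {B : Type*} [DecidableEq B] (a b c d a' b' c' d' : B)
    (h : [a, b, c, d].Nodup) (h' : [a', b', c', d'].Nodup) :
    ∃ s : Equiv.Perm B, s a' = a ∧ s b' = b ∧ s c' = c ∧ s d' = d := by
  have i1 : Function.Injective ![a, b, c, d] := by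
    have := List.nodup_iff_injective_get.1 h
    intro i j hij
    apply this
    fin_cases i <;> fin_cases j <;> simpa using hij
  have i2 : Function.Injective ![a', b', c', d'] := by
    have := List.nodup_iff_injective_get.1 h'
    intro i j hij
    apply this
    fin_cases i <;> fin_cases j <;> simpa using hij
  have := Equiv.Perm.isMultiplyPretransitive B 4
  obtain ⟨s, hs⟩ := this.exists_smul_eq ⟨_, i2⟩ ⟨_, i1⟩
  refine ⟨s, ?_, ?_, ?_, ?_⟩
  · simpa using congrArg (fun f => f 0) hs
  · simpa using congrArg (fun f => f 1) hs
  · simpa using congrArg (fun f => f 2) hs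
  · simpa using congrArg (fun f => f 3) hs

theorem dd_comp {B : Type*} [DecidableEq B] (a b : B) (s : Equiv.Perm B) :
    dd (s a) (s b) ∘ s = dd a b := by
  funext i; simp [dd]

/-- `P(ab,cd) + δ P(cd,ab)`. -/
def ZZ {B : Type*} [DecidableEq B] (δ : ZMod 2) (a b c d : B) : Matrix B B (ZMod 2) :=
  vecMulVec (dd a b) (dd c d) + δ • vecMulVec (dd c d) (dd a b)

theorem ZZ_conj {B : Type*} [DecidableEq B] (δ : ZMod 2) (a b c d : B) (s : Equiv.Perm B) :
    (ZZ δ (s a) (s b) (s c) (s d)).submatrix s s = ZZ δ a b c d := by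
  rw [ZZ, ZZ, ← dd_comp a b s, ← dd_comp c d s]
  ext i j; simp [vecMulVec_apply]

/-- The conclusion we aim at. -/
def Full {B : Type*} [DecidableEq B] (S : Set (Matrix B B (ZMod 2))) : Prop :=
  ∀ a b c : B, a ≠ b → c ≠ b → vecMulVec (dd a b) (dd c b) ∈ S

theorem exists_five {B : Type*} [Fintype B] (s : Finset B)
    (h5 : s.card < Fintype.card B) : ∃ c, c ∉ s := by
  by_contra! h
  have : s = Finset.univ := by ext; simp [h]
  rw [this, Finset.card_univ] at h5
  omega

theorem full_of_diag {B : Type*} [Fintype B] [DecidableEq B] {S : Set (Matrix B B (ZMod 2))}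
    (hS : Good S) (h : ∀ a b : B, a ≠ b → vecMulVec (dd a b) (dd a b) ∈ S) : Full S := by
  intro a b c hab hcb
  by_cases hac : a = c
  · subst hac; exact h a b hab
  · have := hS.mul _ (h a b hab) _ (h c b hcb)
    rw [vecMulVec_mul_vecMulVec, dd_dot _ _ hab] at this
    have e : dd c b a + dd c b b = 1 := by simp [dd, hac, hab]
    rwa [e, one_smul] at this

theorem ZZ_swap {B : Type*} [DecidableEq B] (δ : ZMod 2) (a b c d : B) (hn : [a, b, c, d].Nodup) :
    (ZZ δ a b c d).submatrix (Equiv.swap a b) (Equiv.swap a b) = ZZ δ a b c d := by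
  simp at hn
  ext i j
  have e1 : ∀ i, dd a b (Equiv.swap a b i) = dd a b i := by
    intro i; simp only [dd]; grind
  have e2 : ∀ i, dd c d (Equiv.swap a b i) = dd c d i := by
    intro i; simp only [dd]; grind
  simp only [ZZ, submatrix_apply, Matrix.add_apply, Matrix.smul_apply, vecMulVec_apply, e1, e2]

theorem lemma1 {B : Type*} [Fintype B] [DecidableEq B] {S : Set (Matrix B B (ZMod 2))}
    (hS : Good S) (h5 : 5 ≤ Fintype.card B) (δ : ZMod 2) (a b c d : B) (hn : [a, b, c, d].Nodup)
    (h : ZZ δ a b c d ∈ S) : Full S := by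
  have all : ∀ a' b' c' d' : B, [a', b', c', d'].Nodup → ZZ δ a' b' c' d' ∈ S := by
    intro a' b' c' d' h'
    obtain ⟨s, rfl, rfl, rfl, rfl⟩ := exists_perm4 a b c d a' b' c' d' hn h'
    rw [← ZZ_conj δ a' b' c' d' s]
    refine fullconj hS _ h (s a') (s b') ?_ (ZZ_swap _ _ _ _ _ hn) s
    simp only [List.nodup_cons, List.mem_cons] at hn
    tauto
  refine full_of_diag hS ?_
  intro a b hab
  obtain ⟨c, hc⟩ := exists_five {a, b} (lt_of_le_of_lt Finset.card_le_two (by omega))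
  obtain ⟨d, hd⟩ := exists_five {a, b, c} (lt_of_le_of_lt Finset.card_le_three (by omega))
  obtain ⟨e, he⟩ := exists_five {a, b, c, d} (lt_of_le_of_lt Finset.card_le_four (by omega))
  simp at hc hd he
  rcases z2 δ with rfl | rfl
  · have := hS.mul _ (all a b c d (by simp; grind)) _ (all d e a b (by simp; grind))
    simp only [ZZ, zero_smul, add_zero] at this
    rw [vecMulVec_mul_vecMulVec, dd_dot _ _ (by grind)] at this
    have e : dd d e c + dd d e d = 1 := by simp only [dd]; grind
    rwa [e, one_smul] at this
  · have := hS.mul _ (all a b d e (by simp; grind)) _ (all a b c d (by simp; grind))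
    simp only [ZZ, one_smul, add_mul, mul_add] at this
    simp only [vecMulVec_mul_vecMulVec] at this
    rw [dd_dot _ _ (by grind), dd_dot _ _ (by grind), dd_dot _ _ (by grind),
      dd_dot _ _ (by grind)] at this
    have e1 : dd a b d + dd a b e = 0 := by simp only [dd]; grind
    have e2 : dd a b a + dd a b b = 0 := by simp only [dd]; grind
    have e3 : dd c d d + dd c d e = 1 := by simp only [dd]; grind
    have e4 : dd c d a + dd c d b = 0 := by simp only [dd]; grind
    simp only [e1, e2, e3, e4, one_smul, zero_smul, vecMulVec_zero, add_zero, zero_add] at this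
    exact this

theorem conj_dt {B : Type*} [Fintype B] [DecidableEq B] {S : Set (Matrix B B (ZMod 2))}
    (hS : Good S) (a b c d : B) (hab : a ≠ b) (hcd : c ≠ d) (X : Matrix B B (ZMod 2)) (hX : X ∈ S) :
    X.submatrix (fun i => Equiv.swap a b (Equiv.swap c d i))
      (fun i => Equiv.swap a b (Equiv.swap c d i)) ∈ S :=
  hS.conj (Equiv.swap a b * Equiv.swap c d) (by
    rw [Equiv.Perm.sign_mul, Equiv.Perm.sign_swap hab, Equiv.Perm.sign_swap hcd]; rfl) X hX

set_option maxHeartbeats 4000000 in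
theorem claimA_core {B : Type*} [Fintype B] [DecidableEq B] {S : Set (Matrix B B (ZMod 2))}
    (hS : Good S) (h5 : 5 ≤ Fintype.card B) (X : Matrix B B (ZMod 2)) (hX : X ∈ S)
    (a b c d p q x : B) (hn : [a, b, c, d, p, q, x].Nodup)
    (hB : X a c + X c a + X b d + X d b = X a d + X d a + X b c + X c b)
    (hC : X a p + X b p + X c p + X d p + (X a q + X b q + X c q + X d q) = 1) : Full S := by
  have hn' := hn
  simp only [List.nodup_cons, List.mem_cons, List.not_mem_nil, or_false, not_or, List.nodup_nil,
    and_true, not_false_eq_true] at hn'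
  obtain ⟨⟨ab, ac, ad, ap, aq, ax⟩, ⟨bc, bd, bp, bq, bx⟩, ⟨cd, cp, cq, cx⟩, ⟨dp, dq, dx⟩, ⟨pq, px⟩,
    qx⟩ := hn'
  have h1 := conj_dt hS a b c d ab cd X hX
  have h2 := conj_dt hS a c b d ac bd X hX
  have h3 := conj_dt hS a d b c ad bc X hX
  have hW := hS.add _ (hS.add _ (hS.add _ hX _ h1) _ h2) _ h3
  have hY := hS.add _ hW _ (conj_dt hS a b p q ab pq _ hW)
  obtain ⟨ρ, hρ⟩ : ∃ ρ, ρ = X p a + X p b + X p c + X p d + (X q a + X q b + X q c + X q d) :=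
    ⟨_, rfl⟩
  set Y := vecMulVec (dd a b + dd c d) (dd p q) + ρ • vecMulVec (dd p q) (dd a b + dd c d) with hYd
  have hYS : Y ∈ S := by
    convert hY using 1
    ext i j
    have key : ∀ i : B, i = a ∨ i = b ∨ i = c ∨ i = d ∨ i = p ∨ i = q ∨
      (i ≠ a ∧ i ≠ b ∧ i ≠ c ∧ i ≠ d ∧ i ≠ p ∧ i ≠ q) := by intro i; tauto
    simp only [hYd, Matrix.add_apply, Matrix.smul_apply, vecMulVec_apply, submatrix_apply,
      Pi.add_apply, dd, Equiv.swap_apply_def, smul_eq_mul]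
    rcases key i with rfl | rfl | rfl | rfl | rfl | rfl | ⟨i1, i2, i3, i4, i5, i6⟩ <;>
    rcases key j with rfl | rfl | rfl | rfl | rfl | rfl | ⟨j1, j2, j3, j4, j5, j6⟩ <;>
    simp only [*, Ne.symm ab, Ne.symm ac, Ne.symm ad, Ne.symm ap, Ne.symm aq, Ne.symm bc,
      Ne.symm bd, Ne.symm bp, Ne.symm bq, Ne.symm cd, Ne.symm cp, Ne.symm cq, Ne.symm dp,
      Ne.symm dq, Ne.symm pq, if_true, if_false, or_self, or_true, true_or, or_false, false_or] <;>
    clear * - hB hC <;> grind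
  have hfix : Y.submatrix (Equiv.swap a b) (Equiv.swap a b) = Y := by
    ext i j
    have e1 : ∀ i, dd a b (Equiv.swap a b i) = dd a b i := by
      intro i; simp only [dd]; grind
    have e2 : ∀ i, dd c d (Equiv.swap a b i) = dd c d i := by
      intro i; simp only [dd]; grind
    have e3 : ∀ i, dd p q (Equiv.swap a b i) = dd p q i := by
      intro i; simp only [dd]; grind
    simp only [hYd, submatrix_apply, Matrix.add_apply, Matrix.smul_apply, vecMulVec_apply, e1, e2,
      e3, Pi.add_apply]
  have hfin := hS.add _ hYS _ (fullconj hS Y hYS a b ab hfix (Equiv.swap a x))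
  refine lemma1 hS h5 ρ a x p q (by simp; grind) ?_
  convert hfin using 1
  ext i j
  have e1 : ∀ i, dd a b (Equiv.swap a x i) + dd c d (Equiv.swap a x i)
      = dd a b i + dd c d i + dd a x i := by
    intro i; simp only [dd]; grind
  have e3 : ∀ i, dd p q (Equiv.swap a x i) = dd p q i := by
    intro i; simp only [dd]; grind
  simp only [ZZ, hYd, submatrix_apply, Matrix.add_apply, Matrix.smul_apply, vecMulVec_apply, e1,
      e3, Pi.add_apply, smul_eq_mul]
  clear * -
  grind

theorem claimA {B : Type*} [Fintype B] [DecidableEq B] {S : Set (Matrix B B (ZMod 2))}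
    (hS : Good S) (h5 : 5 ≤ Fintype.card B) (X : Matrix B B (ZMod 2)) (hX : X ∈ S)
    (a b c d p q x : B) (hn : [a, b, c, d, p, q, x].Nodup)
    (hC : X a p + X b p + X c p + X d p + (X a q + X b q + X c q + X d q) = 1) : Full S := by
  have pig : ∀ u v w : ZMod 2, u = v ∨ u = w ∨ v = w := by decide
  have hn1 : [a, c, b, d, p, q, x].Nodup := by
    refine (List.Perm.nodup_iff ?_).1 hn
    exact List.Perm.cons _ (List.Perm.swap _ _ _)
  have hn2 : [a, d, b, c, p, q, x].Nodup := by
    refine (List.Perm.nodup_iff ?_).1 hn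
    exact List.Perm.cons _ ((List.Perm.cons _ (List.Perm.swap _ _ _)).trans (List.Perm.swap _ _ _))
  rcases pig (X a b + X b a + X c d + X d c) (X a c + X c a + X b d + X d b)
    (X a d + X d a + X b c + X c b) with h | h | h
  · exact claimA_core hS h5 X hX a d b c p q x hn2 (by linear_combination h)
      (by linear_combination hC)
  · exact claimA_core hS h5 X hX a c b d p q x hn1 (by linear_combination h)
      (by linear_combination hC)
  · exact claimA_core hS h5 X hX a b c d p q x hn h hC

theorem minor {B : Type*} [Fintype B] [DecidableEq B] {S : Set (Matrix B B (ZMod 2))}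
    (hS : Good S) (h7 : 7 ≤ Fintype.card B) (X : Matrix B B (ZMod 2)) (hX : X ∈ S)
    (d e p q : B) (hn : [d, e, p, q].Nodup)
    (hC : X d p + X e p + X d q + X e q = 1) : Full S := by
  obtain ⟨a, ha⟩ := exists_five {d, e, p, q} (lt_of_le_of_lt Finset.card_le_four (by omega))
  obtain ⟨b, hb⟩ := exists_five {a, d, e, p, q} (lt_of_le_of_lt Finset.card_le_five (by omega))
  obtain ⟨c, hc⟩ := exists_five {b, a, d, e, p, q} (lt_of_le_of_lt Finset.card_le_six (by omega))
  simp only [Finset.mem_insert, Finset.mem_singleton, not_or] at ha hb hc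
  simp only [List.nodup_cons, List.mem_cons, List.not_mem_nil, or_false, not_or, List.nodup_nil,
    and_true, not_false_eq_true] at hn
  have n1 : [a, b, c, d, p, q, e].Nodup := by
    simp only [List.nodup_cons, List.mem_cons, List.not_mem_nil, or_false, not_or, List.nodup_nil,
      and_true, not_false_eq_true]
    clear hS hX hC; grind
  have n2 : [a, b, c, e, p, q, d].Nodup := by
    simp only [List.nodup_cons, List.mem_cons, List.not_mem_nil, or_false, not_or, List.nodup_nil,
      and_true, not_false_eq_true]
    clear hS hX hC; grind
  rcases z2 (X a p + X b p + X c p + X d p + (X a q + X b q + X c q + X d q)) with h | h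
  · refine claimA hS (by omega) X hX a b c e p q d n2 ?_
    clear * - h hC
    grind
  · exact claimA hS (by omega) X hX a b c d p q e n1 h

theorem odd_cast (n : ℕ) (h : Odd n) : (n : ZMod 2) = 1 := (ZMod.natCast_eq_one_iff_odd).2 h

theorem big {B : Type*} [Fintype B] [DecidableEq B] {S : Set (Matrix B B (ZMod 2))}
    (hS : Good S) (hodd : Odd (Fintype.card B)) (h7 : 7 ≤ Fintype.card B)
    (X : Matrix B B (ZMod 2)) (hX : X ∈ S) : X = 0 ∨ X = Em B ∨ Full S := by
  by_cases hF : Full S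
  · exact Or.inr (Or.inr hF)
  have hcard : (Fintype.card B : ZMod 2) = 1 := odd_cast _ hodd
  have hmin : ∀ Y ∈ S, ∀ d e p q : B, [d, e, p, q].Nodup → Y d p + Y e p + Y d q + Y e q = 0 := by
    intro Y hY d e p q hn
    rcases z2 (Y d p + Y e p + Y d q + Y e q) with h | h
    · exact h
    · exact absurd (minor hS h7 Y hY d e p q hn h) hF
  have hm : ∀ d e p q : B, d ≠ e → d ≠ p → d ≠ q → e ≠ p → e ≠ q → p ≠ q →
      X d p + X e p + X d q + X e q = 0 := by
    intro d e p q h1 h2 h3 h4 h5 h6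
    exact hmin X hX d e p q (by simp; tauto)
  have third : ∀ a b : B, ∃ c, c ≠ a ∧ c ≠ b := by
    intro a b
    obtain ⟨c, hc⟩ := exists_five {a, b} (lt_of_le_of_lt Finset.card_le_two (by omega))
    simp at hc; exact ⟨c, by tauto⟩
  have fourth : ∀ a b d : B, ∃ c, c ≠ a ∧ c ≠ b ∧ c ≠ d := by
    intro a b d
    obtain ⟨c, hc⟩ := exists_five {a, b, d} (lt_of_le_of_lt Finset.card_le_three (by omega))
    simp at hc; exact ⟨c, by tauto⟩
  have sumc : ∀ (f : B → ZMod 2) (a b : B) (k : ZMod 2), a ≠ b →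
      (∀ p, p ≠ a → p ≠ b → f p = k) → ∑ p, f p = f a + f b + k := by
    intro f a b k hab hf
    have : ∀ p, f p = (if p = a then f a + k else 0) + (if p = b then f b + k else 0) + k := by
      intro p
      by_cases h1 : p = a
      · subst h1; simp [hab]; grind
      by_cases h2 : p = b
      · subst h2; simp [Ne.symm hab]; grind
      simp [h1, h2, hf p h1 h2]
    rw [Finset.sum_congr rfl (fun p _ => this p)]
    simp [Finset.sum_add_distrib, hcard]
    grind
  have hrow : ∀ i j p, i ≠ j → p ≠ i → p ≠ j → X i i + X j j = X i j + X j i + (X i p + X j p) := by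
    intro i j p hij hpi hpj
    have := sumc (fun q => X i q + X j q) i j (X i p + X j p) hij (by
      intro q hqi hqj
      by_cases hpq : p = q
      · rw [hpq]
      have := hm i j p q hij (Ne.symm hpi) (Ne.symm hqi) (Ne.symm hpj) (Ne.symm hqj) hpq
      clear * - this; grind)
    rw [Finset.sum_add_distrib, hS.row X hX, hS.row X hX] at this
    clear * - this; grind
  have hcol : ∀ i j p, i ≠ j → p ≠ i → p ≠ j → X i i + X j j = X i j + X j i + (X p i + X p j) := by
    intro i j p hij hpi hpj
    have := sumc (fun q => X q i + X q j) i j (X p i + X p j) hij (by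
      intro q hqi hqj
      by_cases hpq : p = q
      · rw [hpq]
      have := hm p q i j hpq hpi hpj hqi hqj hij
      clear * - this; grind)
    rw [Finset.sum_add_distrib, hS.col X hX, hS.col X hX] at this
    clear * - this; grind
  have hsym1 : ∀ i j p, i ≠ j → p ≠ i → p ≠ j → X i p + X p i = X j p + X p j := by
    intro i j p h1 h2 h3
    have e1 := hrow i j p h1 h2 h3
    have e2 := hcol i j p h1 h2 h3
    clear * - e1 e2; grind
  have hsym : ∀ i j, i ≠ j → X i j = X j i := by
    intro i j hij
    obtain ⟨p, hpi, hpj⟩ := third i j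
    obtain ⟨q, hqi, hqj, hqp⟩ := fourth i j p
    have e1 := hrow i j q hij hqi hqj
    have e2 := hrow i p q hpi.symm hqi hqp
    have e3 := hrow j p q hpj.symm hqj hqp
    have e4 := hsym1 i j p hij hpi hpj
    have e5 := hsym1 i p j hpi.symm hij.symm hpj.symm
    have e6 := hsym1 j p i hpj.symm hij hpi.symm
    clear * - e1 e2 e3 e4 e5 e6
    grind
  have hd : ∀ i j p, i ≠ j → p ≠ i → p ≠ j → X i i + X j j = X i p + X j p := by
    intro i j p h1 h2 h3
    have e1 := hrow i j p h1 h2 h3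
    have e2 := hsym i j h1
    clear * - e1 e2; grind
  have hne : ∃ a b : B, a ≠ b := by
    have : 1 < Fintype.card B := by omega
    obtain ⟨a, b, h⟩ := Fintype.one_lt_card_iff.1 this
    exact ⟨a, b, h⟩
  obtain ⟨o, o', hoo⟩ := hne
  obtain ⟨k, hk⟩ : ∃ k, ∀ i j, i ≠ j → X i j = X i i + X j j + k := by
    refine ⟨X o o' + X o o + X o' o', ?_⟩
    have step : ∀ i j p, i ≠ j → p ≠ i → p ≠ j →
        X i p + X i i + X p p = X j p + X j j + X p p := by
      intro i j p h1 h2 h3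
      have := hd i j p h1 h2 h3
      clear * - this; grind
    have sy : ∀ i j, i ≠ j → X i j + X i i + X j j = X j i + X j j + X i i := by
      intro i j h
      have := hsym i j h
      clear * - this; grind
    have main : ∀ i j, i ≠ j → X i j + X i i + X j j = X o o' + X o o + X o' o' := by
      intro i j hij
      obtain ⟨p, hp1, hp2, hp3⟩ := fourth i j o
      have e1 : X i j + X i i + X j j = X i p + X i i + X p p := by
        rw [sy i j hij, sy i p hp1.symm]; exact step j p i hp2.symm hij hp1.symm
      have e2 : X i p + X i i + X p p = X o p + X o o + X p p := by
        by_cases h : i = o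
        · rw [h]
        · exact step i o p h hp1 hp3
      have e3 : X o p + X o o + X p p = X o o' + X o o + X o' o' := by
        by_cases h : p = o'
        · rw [h]
        · rw [sy o p hp3.symm, sy o o' hoo]; exact step p o' o h hp3.symm hoo
      rw [e1, e2, e3]
    intro i j hij
    have := main i j hij
    clear * - this; grind
  by_cases hconst : ∀ a b, X a a = X b b
  ·
    have hk2 : ∀ i j, i ≠ j → X i j = k := by
      intro i j hij
      rw [hk i j hij, hconst i j]; clear * -; grind
    have r := sumc (fun q => X o q) o o' k hoo (fun p h1 _ => hk2 o p h1.symm)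
    rw [hS.row X hX] at r
    have h0 : ∀ i, X i i = 0 := by
      intro i
      rw [hconst i o]
      have := hk2 o o' hoo
      have r : 0 = X o o + X o o' + k := r
      clear * - this r; grind
    rcases z2 k with rfl | rfl
    · left; ext i j
      by_cases h : i = j
      · subst h; simp [h0]
      · simp [hk2 i j h]
    · right; left; ext i j
      by_cases h : i = j
      · subst h; simp [h0, Em]
      · simp [hk2 i j h, Em, h]
  · exfalso
    push Not at hconst
    obtain ⟨a, b, hab⟩ := hconst
    have nab : a ≠ b := by rintro rfl; exact hab rfl
    obtain ⟨p, q, npq, hpq, pa, pb, qa, qb⟩ : ∃ p q, p ≠ q ∧ X p p = X q q ∧ p ≠ a ∧ p ≠ b ∧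
        q ≠ a ∧ q ≠ b := by
      obtain ⟨c, hc⟩ := exists_five {a, b} (lt_of_le_of_lt Finset.card_le_two (by omega))
      obtain ⟨d, hd⟩ := exists_five {a, b, c} (lt_of_le_of_lt Finset.card_le_three (by omega))
      obtain ⟨e, he⟩ := exists_five {a, b, c, d} (lt_of_le_of_lt Finset.card_le_four (by omega))
      simp only [Finset.mem_insert, Finset.mem_singleton, not_or] at hc hd he
      have pig : ∀ u v w : ZMod 2, u = v ∨ u = w ∨ v = w := by decide
      rcases pig (X c c) (X d d) (X e e) with h | h | h
      · exact ⟨c, d, by tauto, h, by tauto, by tauto, by tauto, by tauto⟩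
      · exact ⟨c, e, by tauto, h, by tauto, by tauto, by tauto, by tauto⟩
      · exact ⟨d, e, by tauto, h, by tauto, by tauto, by tauto, by tauto⟩
    have hY := hS.add _ hX _ (conj_dt hS a b p q nab npq X hX)
    set Y := X + X.submatrix (fun i => Equiv.swap a b (Equiv.swap p q i))
      (fun i => Equiv.swap a b (Equiv.swap p q i)) with hYd
    have hab1 : X a a + X b b = 1 := by
      clear * - hab
      rcases z2 (X a a) with h | h <;> rcases z2 (X b b) with h' | h' <;> simp_all
    have hf : ∀ i, X i i + X (Equiv.swap a b (Equiv.swap p q i)) (Equiv.swap a b (Equiv.swap p q i))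
        = dd a b i := by
      intro i
      simp only [dd, Equiv.swap_apply_def]
      clear hk hd hsym hsym1 hcol hrow sumc fourth third hm hmin hS hX hY hYd hF
      grind
    have hYe : ∀ i j, Y i j = if i = j then dd a b i else dd a b i + dd a b j := by
      intro i j
      by_cases h : i = j
      · subst h
        simp only [hYd, Matrix.add_apply, submatrix_apply, if_true, hf]
      · simp only [hYd, Matrix.add_apply, submatrix_apply, if_neg h]
        have h' : Equiv.swap a b (Equiv.swap p q i) ≠ Equiv.swap a b (Equiv.swap p q j) := by
          simpa using h
        rw [← hf i, ← hf j]
        generalize Equiv.swap a b (Equiv.swap p q i) = u at *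
        generalize Equiv.swap a b (Equiv.swap p q j) = v at *
        rw [hk i j h, hk u v h']
        clear * -
        grind
    have hYY := hmin _ (hS.mul _ hY _ hY) a p b q (by simp; grind)
    simp only [Matrix.mul_apply] at hYY
    rw [← Finset.sum_add_distrib, ← Finset.sum_add_distrib, ← Finset.sum_add_distrib] at hYY
    rw [sumc _ a b 1 nab (by
      intro l hla hlb
      simp only [hYe, dd]
      clear hk hd hsym hsym1 hcol hrow sumc fourth third hm hmin hS hX hY hYd hF hYe hf
      grind)] at hYY
    simp only [hYe, dd] at hYY
    clear hk hd hsym hsym1 hcol hrow sumc fourth third hm hmin hS hX hY hYd hF hYe hf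
    grind

theorem dd_swap_self {B : Type*} [DecidableEq B] (a b i : B) :
    dd a b (Equiv.swap a b i) = dd a b i := by
  simp only [dd]; grind

theorem dd_swap_off {B : Type*} [DecidableEq B] (a b c d i : B) (h1 : c ≠ a) (h2 : c ≠ b)
    (h3 : d ≠ a) (h4 : d ≠ b) : dd c d (Equiv.swap a b i) = dd c d i := by
  simp only [dd]; grind

theorem dd_swap_right {B : Type*} [DecidableEq B] (c d e i : B) (h1 : c ≠ d) (h2 : c ≠ e) :
    dd c d (Equiv.swap d e i) = dd c e i := by
  simp only [dd]; grind

theorem dd_swap_left {B : Type*} [DecidableEq B] (c d e i : B) (h1 : c ≠ d) (h2 : c ≠ e) :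
    dd d c (Equiv.swap d e i) = dd e c i := by
  simp only [dd]; grind

set_option maxHeartbeats 1000000 in
theorem lemma2b {B : Type*} [Fintype B] [DecidableEq B] {S : Set (Matrix B B (ZMod 2))}
    (hS : Good S) (h5 : 5 ≤ Fintype.card B) (a b c d e : B) (hn : [a, b, c, d, e].Nodup)
    (h : vecMulVec (dd a b) (dd a b) + vecMulVec (dd c d) (dd c d) ∈ S) : Full S := by
  simp only [List.nodup_cons, List.mem_cons, List.not_mem_nil, or_false, not_or, List.nodup_nil,
    and_true, not_false_eq_true] at hn
  obtain ⟨⟨ab, ac, ad, ae⟩, ⟨bc, bd, be⟩, ⟨cd, ce⟩, de⟩ := hn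
  have f1 : ∀ i, dd a b (Equiv.swap a b i) = dd a b i := fun i => dd_swap_self _ _ _
  have f2 : ∀ i, dd c d (Equiv.swap a b i) = dd c d i := fun i =>
    dd_swap_off _ _ _ _ _ (Ne.symm ac) (Ne.symm bc) (Ne.symm ad) (Ne.symm bd)
  have f3 : ∀ i, dd c e (Equiv.swap a b i) = dd c e i := fun i =>
    dd_swap_off _ _ _ _ _ (Ne.symm ac) (Ne.symm bc) (Ne.symm ae) (Ne.symm be)
  have f4 : ∀ i, dd a b (Equiv.swap d e i) = dd a b i := fun i =>
    dd_swap_off _ _ _ _ _ ad ae bd be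
  have f5 : ∀ i, dd c d (Equiv.swap d e i) = dd c e i := fun i =>
    dd_swap_right _ _ _ _ cd ce
  have h' := fullconj hS _ h a b ab (by
    ext i j
    simp only [submatrix_apply, Matrix.add_apply, vecMulVec_apply, f1, f2]) (Equiv.swap d e)
  have e1 : (vecMulVec (dd a b) (dd a b) + vecMulVec (dd c d) (dd c d)).submatrix (Equiv.swap d e)
      (Equiv.swap d e) = vecMulVec (dd a b) (dd a b) + vecMulVec (dd c e) (dd c e) := by
    ext i j
    simp only [submatrix_apply, Matrix.add_apply, vecMulVec_apply, f4, f5]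
  rw [e1] at h'
  have hP := hS.mul _ h _ h'
  simp only [add_mul, mul_add, vecMulVec_mul_vecMulVec] at hP
  rw [dd_dot _ _ ab, dd_dot _ _ cd, dd_dot _ _ ab, dd_dot _ _ cd] at hP
  have g1 : dd a b a + dd a b b = 0 := by clear * - ab ac ad ae bc bd be cd ce de; simp only [dd]; grind
  have g2 : dd c e a + dd c e b = 0 := by clear * - ab ac ad ae bc bd be cd ce de; simp only [dd]; grind
  have g3 : dd a b c + dd a b d = 0 := by clear * - ab ac ad ae bc bd be cd ce de; simp only [dd]; grind
  have g4 : dd c e c + dd c e d = 1 := by clear * - ab ac ad ae bc bd be cd ce de; simp only [dd]; grind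
  simp only [g1, g2, g3, g4, one_smul, zero_smul, vecMulVec_zero, add_zero, zero_add] at hP
  have hfull := fullconj hS _ hP a b ab (by
    ext i j
    simp only [submatrix_apply, vecMulVec_apply, f2, f3])
  have all : ∀ x y z : B, x ≠ y → x ≠ z → y ≠ z → vecMulVec (dd x y) (dd x z) ∈ S := by
    intro x y z xy xz yz
    obtain ⟨w, hw⟩ := exists_five {x, y, z} (lt_of_le_of_lt Finset.card_le_three (by omega))
    simp only [Finset.mem_insert, Finset.mem_singleton, not_or] at hw
    obtain ⟨s, h1, h2, h3, _⟩ := exists_perm4 c d e a x y z w (by clear * - ab ac ad ae bc bd be cd ce de; simp; grind)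
      (by clear * - xy yz xz hw; simp; grind)
    have := hfull s
    convert this using 1
    rw [← h1, ← h2, ← h3]
    ext i j
    simp [vecMulVec_apply, dd]
  refine full_of_diag hS ?_
  intro x y xy
  obtain ⟨z, hz⟩ := exists_five {x, y} (lt_of_le_of_lt Finset.card_le_two (by omega))
  simp only [Finset.mem_insert, Finset.mem_singleton, not_or] at hz
  have := hS.mul _ (all x y z xy (Ne.symm hz.1) (Ne.symm hz.2)) _
    (all y z x (Ne.symm hz.2) (Ne.symm xy) hz.1)
  rw [vecMulVec_mul_vecMulVec, dd_dot _ _ (Ne.symm hz.1)] at this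
  have g : dd y z x + dd y z z = 1 := by clear * - xy hz; simp only [dd]; grind
  rw [g, one_smul] at this
  convert this using 2
  funext i; clear * - xy hz; simp only [dd]; grind

set_option maxHeartbeats 1000000 in
theorem lemma2c {B : Type*} [Fintype B] [DecidableEq B] {S : Set (Matrix B B (ZMod 2))}
    (hS : Good S) (h5 : 5 ≤ Fintype.card B) (a b c d e : B) (hn : [a, b, c, d, e].Nodup)
    (h : vecMulVec (dd a b + dd c d) (dd a b + dd c d) ∈ S) : Full S := by
  simp only [List.nodup_cons, List.mem_cons, List.not_mem_nil, or_false, not_or, List.nodup_nil,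
    and_true, not_false_eq_true] at hn
  obtain ⟨⟨ab, ac, ad, ae⟩, ⟨bc, bd, be⟩, ⟨cd, ce⟩, de⟩ := hn
  have f1 : ∀ i, dd a b (Equiv.swap a b i) = dd a b i := by
    intro i; clear * - ab ac ad ae bc bd be cd ce de; simp only [dd]; grind
  have f2 : ∀ i, dd c d (Equiv.swap a b i) = dd c d i := by
    intro i; clear * - ab ac ad ae bc bd be cd ce de; simp only [dd]; grind
  have hfull := fullconj hS _ h a b ab (by
    ext i j
    simp only [submatrix_apply, Pi.add_apply, vecMulVec_apply, f1, f2])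
  have ua : vecMulVec (dd e b + dd c d) (dd e b + dd c d) ∈ S := by
    convert hfull (Equiv.swap a e) using 1
    have : ∀ i, dd a b (Equiv.swap a e i) + dd c d (Equiv.swap a e i) = dd e b i + dd c d i := by
      intro i; clear * - ab ac ad ae bc bd be cd ce de; simp only [dd]; grind
    ext i j
    simp only [submatrix_apply, Pi.add_apply, vecMulVec_apply, this]
  have ub : vecMulVec (dd a e + dd c d) (dd a e + dd c d) ∈ S := by
    convert hfull (Equiv.swap b e) using 1
    have : ∀ i, dd a b (Equiv.swap b e i) + dd c d (Equiv.swap b e i) = dd a e i + dd c d i := by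
      intro i; clear * - ab ac ad ae bc bd be cd ce de; simp only [dd]; grind
    ext i j
    simp only [submatrix_apply, Pi.add_apply, vecMulVec_apply, this]
  have uc : vecMulVec (dd a b + dd e d) (dd a b + dd e d) ∈ S := by
    convert hfull (Equiv.swap c e) using 1
    have : ∀ i, dd a b (Equiv.swap c e i) + dd c d (Equiv.swap c e i) = dd a b i + dd e d i := by
      intro i; clear * - ab ac ad ae bc bd be cd ce de; simp only [dd]; grind
    ext i j
    simp only [submatrix_apply, Pi.add_apply, vecMulVec_apply, this]
  have ud : vecMulVec (dd a b + dd c e) (dd a b + dd c e) ∈ S := by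
    convert hfull (Equiv.swap d e) using 1
    have : ∀ i, dd a b (Equiv.swap d e i) + dd c d (Equiv.swap d e i) = dd a b i + dd c e i := by
      intro i; clear * - ab ac ad ae bc bd be cd ce de; simp only [dd]; grind
    ext i j
    simp only [submatrix_apply, Pi.add_apply, vecMulVec_apply, this]
  have hp := hS.mul _ (hS.add _ ua _ ub) _ (hS.add _ uc _ ud)
  simp only [add_mul, mul_add, vecMulVec_mul_vecMulVec, add_dotProduct] at hp
  rw [dd_dot _ _ (Ne.symm be), dd_dot _ _ cd, dd_dot _ _ ae, dd_dot _ _ cd,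
    dd_dot _ _ (Ne.symm be), dd_dot _ _ ae] at hp
  refine lemma1 hS h5 0 a b c d (by clear * - ab ac ad ae bc bd be cd ce de; simp; grind) ?_
  convert hp using 1
  have g1 : (dd a b + dd e d) e + (dd a b + dd e d) b +
    ((dd a b + dd e d) c + (dd a b + dd e d) d) = 1 := by
    clear * - ab ac ad ae bc bd be cd ce de; simp only [dd, Pi.add_apply]; grind
  have g2 : (dd a b + dd e d) a + (dd a b + dd e d) e +
    ((dd a b + dd e d) c + (dd a b + dd e d) d) = 1 := by
    clear * - ab ac ad ae bc bd be cd ce de; simp only [dd, Pi.add_apply]; grind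
  have g3 : (dd a b + dd c e) e + (dd a b + dd c e) b +
    ((dd a b + dd c e) c + (dd a b + dd c e) d) = 1 := by
    clear * - ab ac ad ae bc bd be cd ce de; simp only [dd, Pi.add_apply]; grind
  have g4 : (dd a b + dd c e) a + (dd a b + dd c e) e +
    ((dd a b + dd c e) c + (dd a b + dd c e) d) = 1 := by
    clear * - ab ac ad ae bc bd be cd ce de; simp only [dd, Pi.add_apply]; grind
  rw [g1, g2, g3, g4]
  have t1 : ∀ i, dd a b i = dd e b i + dd a e i := by intro i; clear * - ab ac ad ae bc bd be cd ce de; simp only [dd]; grind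
  have t2 : ∀ i, dd c d i = dd e d i + dd c e i := by intro i; clear * - ab ac ad ae bc bd be cd ce de; simp only [dd]; grind
  ext i j
  simp only [ZZ, Matrix.add_apply, Pi.add_apply, vecMulVec_apply, zero_smul, one_smul, add_zero,
    Matrix.zero_apply]
  have t1' := t1 i
  have t2' := t2 j
  clear * - t1' t2'
  grind

theorem cover5 {B : Type*} [Fintype B] [DecidableEq B] (hc : Fintype.card B = 5)
    (a b c d e : B) (hn : [a, b, c, d, e].Nodup) :
    (Finset.univ : Finset B) = {a, b, c, d, e} := by
  symm
  apply Finset.eq_univ_of_card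
  rw [hc]
  have := List.toFinset_card_of_nodup hn
  simpa using this

theorem sum5 {B : Type*} [Fintype B] [DecidableEq B] (hc : Fintype.card B = 5)
    (a b c d e : B) (hn : [a, b, c, d, e].Nodup) (f : B → ZMod 2) :
    ∑ i, f i = f a + f b + f c + f d + f e := by
  rw [cover5 hc a b c d e hn]
  simp only [List.nodup_cons, List.mem_cons, List.not_mem_nil, or_false, not_or, List.nodup_nil,
    and_true, not_false_eq_true] at hn
  rw [Finset.sum_insert (by simp; tauto), Finset.sum_insert (by simp; tauto),
    Finset.sum_insert (by simp; tauto), Finset.sum_insert (by simp; tauto), Finset.sum_singleton]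
  ring

theorem ext5 {B : Type*} [Fintype B] [DecidableEq B] (hc : Fintype.card B = 5)
    (a b c d e : B) (hn : [a, b, c, d, e].Nodup) (i : B) :
    i = a ∨ i = b ∨ i = c ∨ i = d ∨ i = e := by
  have := Finset.mem_univ i
  rw [cover5 hc a b c d e hn] at this
  simpa using this

set_option maxHeartbeats 4000000 in
theorem F1 {B : Type*} [Fintype B] [DecidableEq B] {S : Set (Matrix B B (ZMod 2))}
    (hS : Good S) (hc : Fintype.card B = 5) (X : Matrix B B (ZMod 2)) (hX : X ∈ S)
    (hF : ¬ Full S) (a b c d e : B) (hn : [a, b, c, d, e].Nodup) :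
    X a b + X b a + X c d + X d c = X e e := by
  have hn' := hn
  simp only [List.nodup_cons, List.mem_cons, List.not_mem_nil, or_false, not_or, List.nodup_nil,
    and_true, not_false_eq_true] at hn'
  obtain ⟨⟨ab, ac, ad, ae⟩, ⟨bc, bd, be⟩, ⟨cd, ce⟩, de⟩ := hn'
  have key := ext5 hc a b c d e hn
  have h1 := conj_dt hS a b c d ab cd X hX
  have h2 := conj_dt hS a c b d ac bd X hX
  have h3 := conj_dt hS a d b c ad bc X hX
  have hW := hS.add _ (hS.add _ (hS.add _ hX _ h1) _ h2) _ h3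
  have hW' : X + X.submatrix (fun i => Equiv.swap a b (Equiv.swap c d i))
      (fun i => Equiv.swap a b (Equiv.swap c d i)) +
      X.submatrix (fun i => Equiv.swap a c (Equiv.swap b d i))
      (fun i => Equiv.swap a c (Equiv.swap b d i)) +
      X.submatrix (fun i => Equiv.swap a d (Equiv.swap b c i))
      (fun i => Equiv.swap a d (Equiv.swap b c i)) + X e e • Em B ∈ S := by
    rcases z2 (X e e) with h | h
    · rw [h, zero_smul, add_zero]; exact hW
    · rw [h, one_smul]; exact hS.add _ hW _ hS.one
  have r : ∀ i, X i a + X i b + X i c + X i d + X i e = 0 := fun i => by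
    rw [← sum5 hc a b c d e hn]; exact hS.row X hX i
  have l : ∀ i, X a i + X b i + X c i + X d i + X e i = 0 := fun i => by
    rw [← sum5 hc a b c d e hn (fun j => X j i)]; exact hS.col X hX i
  have ra := r a
  have rb := r b
  have rc := r c
  have rd := r d
  have re := r e
  have le := l e
  have hM : ∀ β₁ β₂ β₃ : ZMod 2, β₁ = X a b + X b a + X c d + X d c + X e e →
      β₂ = X a c + X c a + X b d + X d b + X e e → β₃ = X a d + X d a + X b c + X c b + X e e →
      β₁ • (vecMulVec (dd a b) (dd a b) + vecMulVec (dd c d) (dd c d)) +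
      β₂ • (vecMulVec (dd a c) (dd a c) + vecMulVec (dd b d) (dd b d)) +
      β₃ • (vecMulVec (dd a d) (dd a d) + vecMulVec (dd b c) (dd b c)) ∈ S := by
    intro β₁ β₂ β₃ hb1 hb2 hb3
    convert hW' using 1
    ext i j
    simp only [Matrix.add_apply, Matrix.smul_apply, vecMulVec_apply, submatrix_apply,
      dd, Equiv.swap_apply_def, smul_eq_mul, Em]
    rcases key i with rfl | rfl | rfl | rfl | rfl <;>
    rcases key j with rfl | rfl | rfl | rfl | rfl <;>
    simp only [ab, ac, ad, ae, bc, bd, be, cd, ce, de, Ne.symm ab, Ne.symm ac, Ne.symm ad,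
      Ne.symm ae, Ne.symm bc,
      Ne.symm bd, Ne.symm be, Ne.symm cd, Ne.symm ce, Ne.symm de, if_true, if_false, or_self,
      or_true, true_or, or_false, false_or] <;>
    clear * - hb1 hb2 hb3 ra rb rc rd re le <;> grind
  have hM := hM _ _ _ rfl rfl rfl
  suffices X a b + X b a + X c d + X d c + X e e = 0 by clear * - this; grind
  clear ra rb rc rd re le r l hW' hW h1 h2 h3
  generalize X a b + X b a + X c d + X d c + X e e = β₁ at *
  generalize X a c + X c a + X b d + X d b + X e e = β₂ at *
  generalize X a d + X d a + X b c + X c b + X e e = β₃ at *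
  by_contra hne
  apply hF
  have hb : β₁ = 1 := (z2 β₁).resolve_left hne
  subst hb
  have h5 : 5 ≤ Fintype.card B := by omega
  rcases z2 β₂ with rfl | rfl <;> rcases z2 β₃ with rfl | rfl
  · refine lemma2b hS h5 a b c d e hn ?_
    simpa using hM
  · refine lemma1 hS h5 1 a c b d (by clear * - ab ac ad ae bc bd be cd ce de; simp; grind) ?_
    convert hM using 1
    ext i j
    simp only [ZZ, Matrix.add_apply, Matrix.smul_apply, vecMulVec_apply, dd, smul_eq_mul]
    rcases key i with rfl | rfl | rfl | rfl | rfl <;>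
    rcases key j with rfl | rfl | rfl | rfl | rfl <;>
    simp only [ab, ac, ad, ae, bc, bd, be, cd, ce, de, Ne.symm ab, Ne.symm ac, Ne.symm ad,
      Ne.symm ae, Ne.symm bc,
      Ne.symm bd, Ne.symm be, Ne.symm cd, Ne.symm ce, Ne.symm de, if_true, if_false, or_self,
      or_true, true_or, or_false, false_or] <;> decide
  · refine lemma1 hS h5 1 a d b c (by clear * - ab ac ad ae bc bd be cd ce de; simp; grind) ?_
    convert hM using 1
    ext i j
    simp only [ZZ, Matrix.add_apply, Matrix.smul_apply, vecMulVec_apply, dd, smul_eq_mul]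
    rcases key i with rfl | rfl | rfl | rfl | rfl <;>
    rcases key j with rfl | rfl | rfl | rfl | rfl <;>
    simp only [ab, ac, ad, ae, bc, bd, be, cd, ce, de, Ne.symm ab, Ne.symm ac, Ne.symm ad,
      Ne.symm ae, Ne.symm bc,
      Ne.symm bd, Ne.symm be, Ne.symm cd, Ne.symm ce, Ne.symm de, if_true, if_false, or_self,
      or_true, true_or, or_false, false_or] <;> decide
  · refine lemma2c hS h5 a b c d e hn ?_
    convert hM using 1
    ext i j
    simp only [Pi.add_apply, Matrix.add_apply, Matrix.smul_apply, vecMulVec_apply, dd, smul_eq_mul]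
    rcases key i with rfl | rfl | rfl | rfl | rfl <;>
    rcases key j with rfl | rfl | rfl | rfl | rfl <;>
    simp only [ab, ac, ad, ae, bc, bd, be, cd, ce, de, Ne.symm ab, Ne.symm ac, Ne.symm ad,
      Ne.symm ae, Ne.symm bc,
      Ne.symm bd, Ne.symm be, Ne.symm cd, Ne.symm ce, Ne.symm de, if_true, if_false, or_self,
      or_true, true_or, or_false, false_or] <;> decide

theorem nodup5 {B : Type*} [DecidableEq B] (a b c d e : B) (ab : a ≠ b) (ac : a ≠ c) (ad : a ≠ d)
    (ae : a ≠ e) (bc : b ≠ c) (bd : b ≠ d) (be : b ≠ e) (cd : c ≠ d) (ce : c ≠ e) (de : d ≠ e) :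
    [a, b, c, d, e].Nodup := by
  simp; tauto

theorem F2 {B : Type*} [Fintype B] [DecidableEq B] {S : Set (Matrix B B (ZMod 2))}
    (hS : Good S) (hc : Fintype.card B = 5) (X : Matrix B B (ZMod 2)) (hX : X ∈ S)
    (hF : ¬ Full S) (a b c d e : B) (hn : [a, b, c, d, e].Nodup) :
    X e e = 0 ∧ X a b + X b a = X a c + X c a := by
  have hn' := hn
  simp only [List.nodup_cons, List.mem_cons, List.not_mem_nil, or_false, not_or, List.nodup_nil,
    and_true, not_false_eq_true] at hn'
  obtain ⟨⟨ab, ac, ad, ae⟩, ⟨bc, bd, be⟩, ⟨cd, ce⟩, de⟩ := hn'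
  have k := F1 hS hc X hX hF
  have e1 := k a b c d e (by apply nodup5 <;> first | assumption | (symm; assumption))
  have e2 := k a c b d e (by apply nodup5 <;> first | assumption | (symm; assumption))
  have e3 := k a d b c e (by apply nodup5 <;> first | assumption | (symm; assumption))
  have d1 := k a b c e d (by apply nodup5 <;> first | assumption | (symm; assumption))
  have d2 := k a c b e d (by apply nodup5 <;> first | assumption | (symm; assumption))
  have d3 := k a e b c d (by apply nodup5 <;> first | assumption | (symm; assumption))
  have c1 := k a b e d c (by apply nodup5 <;> first | assumption | (symm; assumption))
  have c2 := k a e b d c (by apply nodup5 <;> first | assumption | (symm; assumption))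
  have c3 := k a d b e c (by apply nodup5 <;> first | assumption | (symm; assumption))
  have b1 := k a e c d b (by apply nodup5 <;> first | assumption | (symm; assumption))
  have b2 := k a c e d b (by apply nodup5 <;> first | assumption | (symm; assumption))
  have b3 := k a d e c b (by apply nodup5 <;> first | assumption | (symm; assumption))
  have a1 := k e b c d a (by apply nodup5 <;> first | assumption | (symm; assumption))
  have a2 := k e c b d a (by apply nodup5 <;> first | assumption | (symm; assumption))
  have a3 := k e d b c a (by apply nodup5 <;> first | assumption | (symm; assumption))
  have r : ∀ i, X i a + X i b + X i c + X i d + X i e = 0 := fun i => by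
    rw [← sum5 hc a b c d e hn]; exact hS.row X hX i
  have l : ∀ i, X a i + X b i + X c i + X d i + X e i = 0 := fun i => by
    rw [← sum5 hc a b c d e hn (fun j => X j i)]; exact hS.col X hX i
  have ra := r a
  have rb := r b
  have rc := r c
  have rd := r d
  have re := r e
  have la := l a
  have lb := l b
  have lc := l c
  have ld := l d
  have le := l e
  clear k r l hF hX hS
  constructor <;> grind

set_option maxHeartbeats 4000000 in
theorem F3 {B : Type*} [Fintype B] [DecidableEq B] {S : Set (Matrix B B (ZMod 2))}
    (hS : Good S) (hc : Fintype.card B = 5) (X : Matrix B B (ZMod 2)) (hX : X ∈ S)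
    (hF : ¬ Full S) (a b c d e : B) (hn : [a, b, c, d, e].Nodup) :
    X a d = X b d := by
  have hn' := hn
  simp only [List.nodup_cons, List.mem_cons, List.not_mem_nil, or_false, not_or, List.nodup_nil,
    and_true, not_false_eq_true] at hn'
  obtain ⟨⟨ab, ac, ad, ae⟩, ⟨bc, bd, be⟩, ⟨cd, ce⟩, de⟩ := hn'
  have key := ext5 hc a b c d e hn
  have hW := hS.add _ hX _ (conj_dt hS a b b c ab bc X hX)
  have k := F2 hS hc X hX hF
  have za := (k b c d e a (by apply nodup5 <;> first | assumption | (symm; assumption))).1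
  have zb := (k a c d e b (by apply nodup5 <;> first | assumption | (symm; assumption))).1
  have zc := (k a b d e c (by apply nodup5 <;> first | assumption | (symm; assumption))).1
  have zd := (k a b c e d (by apply nodup5 <;> first | assumption | (symm; assumption))).1
  have ze := (k a b c d e (by apply nodup5 <;> first | assumption | (symm; assumption))).1
  have kac := (k a b c d e (by apply nodup5 <;> first | assumption | (symm; assumption))).2
  have kad := (k a b d c e (by apply nodup5 <;> first | assumption | (symm; assumption))).2
  have kae := (k a b e c d (by apply nodup5 <;> first | assumption | (symm; assumption))).2
  have kbc := (k b a c d e (by apply nodup5 <;> first | assumption | (symm; assumption))).2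
  have kbd := (k b a d c e (by apply nodup5 <;> first | assumption | (symm; assumption))).2
  have kbe := (k b a e c d (by apply nodup5 <;> first | assumption | (symm; assumption))).2
  have kcb := (k c a b d e (by apply nodup5 <;> first | assumption | (symm; assumption))).2
  have kcd := (k c a d b e (by apply nodup5 <;> first | assumption | (symm; assumption))).2
  have kce := (k c a e b d (by apply nodup5 <;> first | assumption | (symm; assumption))).2
  have kdb := (k d a b c e (by apply nodup5 <;> first | assumption | (symm; assumption))).2
  have kdc := (k d a c b e (by apply nodup5 <;> first | assumption | (symm; assumption))).2
  have kde := (k d a e b c (by apply nodup5 <;> first | assumption | (symm; assumption))).2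
  have keb := (k e a b c d (by apply nodup5 <;> first | assumption | (symm; assumption))).2
  have kec := (k e a c b d (by apply nodup5 <;> first | assumption | (symm; assumption))).2
  have ked := (k e a d b c (by apply nodup5 <;> first | assumption | (symm; assumption))).2
  have r : ∀ i, X i a + X i b + X i c + X i d + X i e = 0 := fun i => by
    rw [← sum5 hc a b c d e hn]; exact hS.row X hX i
  have l : ∀ i, X a i + X b i + X c i + X d i + X e i = 0 := fun i => by
    rw [← sum5 hc a b c d e hn (fun j => X j i)]; exact hS.col X hX i
  have ra := r a
  have la := l a
  have rb := r b
  have lb := l b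
  have rc := r c
  have lc := l c
  have rd := r d
  have ld := l d
  have re := r e
  have le := l e
  have hM : ∀ u v u' v' : ZMod 2, u = X a d + X b d → v = X b d + X c d →
      u' = X a e + X b e → v' = X b e + X c e →
      v • ZZ 1 a b d c + (u + v) • ZZ 1 a c d b + v' • ZZ 1 a b e c + (u' + v') • ZZ 1 a c e b ∈ S := by
    intro u v u' v' hu hv hu' hv'
    convert hW using 1
    clear k r l hF hX hS hW
    ext i j
    simp only [ZZ, Em, Matrix.add_apply, Matrix.smul_apply, vecMulVec_apply, submatrix_apply,
      dd, Equiv.swap_apply_def, smul_eq_mul]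
    rcases key i with rfl | rfl | rfl | rfl | rfl <;>
    rcases key j with rfl | rfl | rfl | rfl | rfl <;>
    simp only [ab, ac, ad, ae, bc, bd, be, cd, ce, de, Ne.symm ab, Ne.symm ac, Ne.symm ad,
      Ne.symm ae, Ne.symm bc,
      Ne.symm bd, Ne.symm be, Ne.symm cd, Ne.symm ce, Ne.symm de, if_true, if_false, or_self,
      or_true, true_or, or_false, false_or] <;>
    clear * - hu hv hu' hv' za zb zc zd ze kac kad kae kbc kbd kbe kcb kcd kce kdb kdc kde keb kec ked ra la rb lb rc lc rd ld re le <;> grind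
  have hM := hM _ _ _ _ rfl rfl rfl rfl
  suffices X a d + X b d = 0 by clear * - this; grind
  clear za zb zc zd ze kac kad kae kbc kbd kbe kcb kcd kce kdb kdc kde keb kec ked ra la rb lb rc lc rd ld re le r l k
  generalize X a d + X b d = u at *
  generalize X b d + X c d = v at *
  generalize X a e + X b e = u' at *
  generalize X b e + X c e = v' at *
  by_contra hne
  apply hF
  have hb : u = 1 := (z2 u).resolve_left hne
  subst hb
  have h5 : 5 ≤ Fintype.card B := by omega
  have hE := hS.add _ hM _ hS.one
  have nd : ∀ p q r s : B, p ≠ q → p ≠ r → p ≠ s → q ≠ r → q ≠ s → r ≠ s → [p, q, r, s].Nodup := by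
    intros; simp; tauto
  rcases z2 v with rfl | rfl <;> rcases z2 u' with rfl | rfl <;> rcases z2 v' with rfl | rfl
  · refine lemma1 hS h5 1 a c d b (by apply nd <;> first | assumption | (symm; assumption)) ?_
    convert hM using 1
    ext i j
    simp only [ZZ, Em, Matrix.add_apply, Matrix.smul_apply, vecMulVec_apply, submatrix_apply,
      dd, Equiv.swap_apply_def, smul_eq_mul]
    rcases key i with rfl | rfl | rfl | rfl | rfl <;>
    rcases key j with rfl | rfl | rfl | rfl | rfl <;>
    simp only [ab, ac, ad, ae, bc, bd, be, cd, ce, de, Ne.symm ab, Ne.symm ac, Ne.symm ad,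
      Ne.symm ae, Ne.symm bc,
      Ne.symm bd, Ne.symm be, Ne.symm cd, Ne.symm ce, Ne.symm de, if_true, if_false, or_self,
      or_true, true_or, or_false, false_or] <;> decide
  · refine lemma1 hS h5 1 b e d a (by apply nd <;> first | assumption | (symm; assumption)) ?_
    convert hE using 1
    ext i j
    simp only [ZZ, Em, Matrix.add_apply, Matrix.smul_apply, vecMulVec_apply, submatrix_apply,
      dd, Equiv.swap_apply_def, smul_eq_mul]
    rcases key i with rfl | rfl | rfl | rfl | rfl <;>
    rcases key j with rfl | rfl | rfl | rfl | rfl <;>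
    simp only [ab, ac, ad, ae, bc, bd, be, cd, ce, de, Ne.symm ab, Ne.symm ac, Ne.symm ad,
      Ne.symm ae, Ne.symm bc,
      Ne.symm bd, Ne.symm be, Ne.symm cd, Ne.symm ce, Ne.symm de, if_true, if_false, or_self,
      or_true, true_or, or_false, false_or] <;> decide
  · refine lemma1 hS h5 1 a c d e (by apply nd <;> first | assumption | (symm; assumption)) ?_
    convert hM using 1
    ext i j
    simp only [ZZ, Em, Matrix.add_apply, Matrix.smul_apply, vecMulVec_apply, submatrix_apply,
      dd, Equiv.swap_apply_def, smul_eq_mul]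
    rcases key i with rfl | rfl | rfl | rfl | rfl <;>
    rcases key j with rfl | rfl | rfl | rfl | rfl <;>
    simp only [ab, ac, ad, ae, bc, bd, be, cd, ce, de, Ne.symm ab, Ne.symm ac, Ne.symm ad,
      Ne.symm ae, Ne.symm bc,
      Ne.symm bd, Ne.symm be, Ne.symm cd, Ne.symm ce, Ne.symm de, if_true, if_false, or_self,
      or_true, true_or, or_false, false_or] <;> decide
  · refine lemma1 hS h5 1 b e d c (by apply nd <;> first | assumption | (symm; assumption)) ?_
    convert hE using 1
    ext i j
    simp only [ZZ, Em, Matrix.add_apply, Matrix.smul_apply, vecMulVec_apply, submatrix_apply,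
      dd, Equiv.swap_apply_def, smul_eq_mul]
    rcases key i with rfl | rfl | rfl | rfl | rfl <;>
    rcases key j with rfl | rfl | rfl | rfl | rfl <;>
    simp only [ab, ac, ad, ae, bc, bd, be, cd, ce, de, Ne.symm ab, Ne.symm ac, Ne.symm ad,
      Ne.symm ae, Ne.symm bc,
      Ne.symm bd, Ne.symm be, Ne.symm cd, Ne.symm ce, Ne.symm de, if_true, if_false, or_self,
      or_true, true_or, or_false, false_or] <;> decide
  · refine lemma1 hS h5 1 a b d c (by apply nd <;> first | assumption | (symm; assumption)) ?_
    convert hM using 1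
    ext i j
    simp only [ZZ, Em, Matrix.add_apply, Matrix.smul_apply, vecMulVec_apply, submatrix_apply,
      dd, Equiv.swap_apply_def, smul_eq_mul]
    rcases key i with rfl | rfl | rfl | rfl | rfl <;>
    rcases key j with rfl | rfl | rfl | rfl | rfl <;>
    simp only [ab, ac, ad, ae, bc, bd, be, cd, ce, de, Ne.symm ab, Ne.symm ac, Ne.symm ad,
      Ne.symm ae, Ne.symm bc,
      Ne.symm bd, Ne.symm be, Ne.symm cd, Ne.symm ce, Ne.symm de, if_true, if_false, or_self,
      or_true, true_or, or_false, false_or] <;> decide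
  · refine lemma1 hS h5 1 c e d a (by apply nd <;> first | assumption | (symm; assumption)) ?_
    convert hE using 1
    ext i j
    simp only [ZZ, Em, Matrix.add_apply, Matrix.smul_apply, vecMulVec_apply, submatrix_apply,
      dd, Equiv.swap_apply_def, smul_eq_mul]
    rcases key i with rfl | rfl | rfl | rfl | rfl <;>
    rcases key j with rfl | rfl | rfl | rfl | rfl <;>
    simp only [ab, ac, ad, ae, bc, bd, be, cd, ce, de, Ne.symm ab, Ne.symm ac, Ne.symm ad,
      Ne.symm ae, Ne.symm bc,
      Ne.symm bd, Ne.symm be, Ne.symm cd, Ne.symm ce, Ne.symm de, if_true, if_false, or_self,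
      or_true, true_or, or_false, false_or] <;> decide
  · refine lemma1 hS h5 1 c e d b (by apply nd <;> first | assumption | (symm; assumption)) ?_
    convert hE using 1
    ext i j
    simp only [ZZ, Em, Matrix.add_apply, Matrix.smul_apply, vecMulVec_apply, submatrix_apply,
      dd, Equiv.swap_apply_def, smul_eq_mul]
    rcases key i with rfl | rfl | rfl | rfl | rfl <;>
    rcases key j with rfl | rfl | rfl | rfl | rfl <;>
    simp only [ab, ac, ad, ae, bc, bd, be, cd, ce, de, Ne.symm ab, Ne.symm ac, Ne.symm ad,
      Ne.symm ae, Ne.symm bc,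
      Ne.symm bd, Ne.symm be, Ne.symm cd, Ne.symm ce, Ne.symm de, if_true, if_false, or_self,
      or_true, true_or, or_false, false_or] <;> decide
  · refine lemma1 hS h5 1 a b d e (by apply nd <;> first | assumption | (symm; assumption)) ?_
    convert hM using 1
    ext i j
    simp only [ZZ, Em, Matrix.add_apply, Matrix.smul_apply, vecMulVec_apply, submatrix_apply,
      dd, Equiv.swap_apply_def, smul_eq_mul]
    rcases key i with rfl | rfl | rfl | rfl | rfl <;>
    rcases key j with rfl | rfl | rfl | rfl | rfl <;>
    simp only [ab, ac, ad, ae, bc, bd, be, cd, ce, de, Ne.symm ab, Ne.symm ac, Ne.symm ad,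
      Ne.symm ae, Ne.symm bc,
      Ne.symm bd, Ne.symm be, Ne.symm cd, Ne.symm ce, Ne.symm de, if_true, if_false, or_self,
      or_true, true_or, or_false, false_or] <;> decide

theorem small {B : Type*} [Fintype B] [DecidableEq B] {S : Set (Matrix B B (ZMod 2))}
    (hS : Good S) (hc : Fintype.card B = 5) (X : Matrix B B (ZMod 2)) (hX : X ∈ S) :
    X = 0 ∨ X = Em B ∨ Full S := by
  by_cases hF : Full S
  · exact Or.inr (Or.inr hF)
  have ex5 : ∀ d p q : B, p ≠ q → p ≠ d → q ≠ d → ∃ c e, [p, q, c, d, e].Nodup := by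
    intro d p q h1 h2 h3
    obtain ⟨c, hcc⟩ := exists_five ({d, p, q} : Finset B)
      (lt_of_le_of_lt Finset.card_le_three (by omega))
    obtain ⟨e, he⟩ := exists_five ({d, p, q, c} : Finset B)
      (lt_of_le_of_lt Finset.card_le_four (by omega))
    simp only [Finset.mem_insert, Finset.mem_singleton, not_or] at hcc he
    refine ⟨c, e, ?_⟩
    simp; tauto
  have colc : ∀ d p q : B, p ≠ d → q ≠ d → X p d = X q d := by
    intro d p q h2 h3
    by_cases h1 : p = q
    · rw [h1]
    obtain ⟨c, e, h⟩ := ex5 d p q h1 h2 h3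
    exact F3 hS hc X hX hF p q c d e h
  obtain ⟨a⟩ : Nonempty B := Fintype.card_pos_iff.1 (by omega)
  obtain ⟨b, hb⟩ := exists_five ({a} : Finset B) (by simp; omega)
  obtain ⟨c', hc'⟩ := exists_five ({a, b} : Finset B)
      (lt_of_le_of_lt Finset.card_le_two (by omega))
  simp only [Finset.mem_insert, Finset.mem_singleton, not_or] at hb hc'
  obtain ⟨c, e, hn⟩ := ex5 a b c' (Ne.symm hc'.2) hb hc'.1
  have key := ext5 hc _ _ _ _ _ hn
  have r : ∀ i, X i b + X i c' + X i c + X i a + X i e = 0 := fun i => by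
    rw [← sum5 hc _ _ _ _ _ hn]; exact hS.row X hX i
  have hn' := hn
  simp only [List.nodup_cons, List.mem_cons, List.not_mem_nil, or_false, not_or, List.nodup_nil,
    and_true, not_false_eq_true] at hn'
  have diag : ∀ i, X i i = 0 := by
    intro i
    have k := F2 hS hc X hX hF
    obtain ⟨⟨ab, ac, ad, ae⟩, ⟨bc, bd, be⟩, ⟨cd, ce⟩, de⟩ := hn'
    rcases key i with h | h | h | h | h <;> rw [h]
    · exact (k c' c a e b (by apply nodup5 <;> first | assumption | (symm; assumption))).1
    · exact (k b c a e c' (by apply nodup5 <;> first | assumption | (symm; assumption))).1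
    · exact (k b c' a e c (by apply nodup5 <;> first | assumption | (symm; assumption))).1
    · exact (k b c' c e a (by apply nodup5 <;> first | assumption | (symm; assumption))).1
    · exact (k b c' c a e (by apply nodup5 <;> first | assumption | (symm; assumption))).1
  have all : ∀ i j, i ≠ j → X i j = X a b := by
    have ra := r a
    have rb := r b
    have rc := r c
    have rd := r c'
    have re := r e
    rw [diag] at ra rb rc rd re
    intro i j hij
    obtain ⟨⟨ab, ac, ad, ae⟩, ⟨bc, bd, be⟩, ⟨cd, ce⟩, de⟩ := hn'
    have q1 : ∀ i, i ≠ b → X i b = X a b := fun i h => colc b i a h (Ne.symm ad)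
    have q2 : ∀ i, i ≠ c' → X i c' = X a c' := fun i h => colc c' i a h (Ne.symm bd)
    have q3 : ∀ i, i ≠ c → X i c = X a c := fun i h => colc c i a h (Ne.symm cd)
    have q4 : ∀ i, i ≠ e → X i e = X a e := fun i h => colc e i a h de
    have q5 : ∀ i, i ≠ a → X i a = X b a := fun i h => colc a i b h ad
    rw [q2 b ab, q3 b ac, q4 b ae] at rb
    rw [q1 c (Ne.symm ac), q2 c (Ne.symm bc), q5 c cd, q4 c ce] at rc
    rw [q1 c' (Ne.symm ab), q3 c' bc, q5 c' bd, q4 c' be] at rd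
    rw [q1 e (Ne.symm ae), q2 e (Ne.symm be), q3 e (Ne.symm ce), q5 e (Ne.symm de)] at re
    rcases key j with rfl | rfl | rfl | rfl | rfl
    · rw [q1 i hij]
    · rw [q2 i hij]; clear * - ra rb rc rd re; grind
    · rw [q3 i hij]; clear * - ra rb rc rd re; grind
    · rw [q5 i hij]; clear * - ra rb rc rd re; grind
    · rw [q4 i hij]; clear * - ra rb rc rd re; grind
  rcases z2 (X a b) with h | h
  · left
    ext i j
    by_cases hij : i = j
    · subst hij; simp [diag]
    · simp [all i j hij, h]
  · right; left
    ext i j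
    by_cases hij : i = j
    · subst hij; simp [diag, Em]
    · simp [all i j hij, h, Em, hij]

theorem mem_QB_iff {B : Type*} [Fintype B] (v : B → ZMod 2) : v ∈ QB B ↔ ∑ i, v i = 0 := by
  simp [QB, LinearMap.mem_ker, LinearMap.sum_apply]

/-- The matrices with even rows and columns that represent elements of `R`. -/
def SR {B : Type*} [Fintype B] [DecidableEq B]
    (R : Subalgebra (ZMod 2) (Module.End (ZMod 2) (QB B))) : Set (Matrix B B (ZMod 2)) :=
  {X | (∀ i, ∑ j, X i j = 0) ∧ (∀ j, ∑ i, X i j = 0) ∧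
    ∃ r ∈ R, ∀ v : QB B, ((r v : QB B) : B → ZMod 2) = X.mulVec (v : B → ZMod 2)}

theorem Em_apply {B : Type*} [Fintype B] [DecidableEq B] (v : B → ZMod 2) (hv : ∑ i, v i = 0) :
    (Em B).mulVec v = v := by
  funext i
  have h : ∀ j, Em B i j * v j = v j + (if i = j then v j else 0) := by
    intro j
    by_cases h : i = j
    · simp only [Em, h, if_true]; grind
    · simp [Em, h]
  simp only [mulVec, dotProduct, h]
  rw [Finset.sum_add_distrib, hv]
  simp

theorem Em_symm {B : Type*} [DecidableEq B] (i j : B) : Em B i j = Em B j i := by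
  simp only [Em, eq_comm]

theorem Em_row {B : Type*} [Fintype B] [DecidableEq B] (hodd : Odd (Fintype.card B)) (i : B) :
    ∑ j, Em B i j = 0 := by
  have h : ∀ j, Em B i j = 1 + (if i = j then 1 else 0) := by
    intro j
    by_cases h : i = j
    · simp only [Em, h, if_true]; grind
    · simp [Em, h]
  simp only [h]
  rw [Finset.sum_add_distrib]
  simp [odd_cast _ hodd]
  decide

theorem good_SR {B : Type*} [Fintype B] [DecidableEq B]
    (hodd : Odd (Fintype.card B))
    (R : Subalgebra (ZMod 2) (Module.End (ZMod 2) (QB B)))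
    (hconj : ∀ s ∈ alternatingGroup B, ∀ r ∈ R,
      permQB s * r * permQB s⁻¹ ∈ R) : Good (SR R) where
  add := by
    rintro X ⟨h1, h2, r, hr, h3⟩ Y ⟨h1', h2', r', hr', h3'⟩
    refine ⟨fun i => ?_, fun j => ?_, r + r', R.add_mem hr hr', fun v => ?_⟩
    · simp [Finset.sum_add_distrib, h1, h1']
    · simp [Finset.sum_add_distrib, h2, h2']
    · rw [add_mulVec, ← h3, ← h3']; rfl
  mul := by
    rintro X ⟨h1, h2, r, hr, h3⟩ Y ⟨h1', h2', r', hr', h3'⟩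
    refine ⟨fun i => ?_, fun j => ?_, r * r', R.mul_mem hr hr', fun v => ?_⟩
    · simp only [Matrix.mul_apply]
      rw [Finset.sum_comm]
      simp [← Finset.mul_sum, h1']
    · simp only [Matrix.mul_apply]
      rw [Finset.sum_comm]
      simp [← Finset.sum_mul, h2]
    · rw [← mulVec_mulVec, ← h3', ← h3]; rfl
  conj := by
    rintro s hs X ⟨h1, h2, r, hr, h3⟩
    refine ⟨fun i => ?_, fun j => ?_, _,
      hconj s⁻¹ (by simp [Equiv.Perm.mem_alternatingGroup, hs]) r hr, fun v => ?_⟩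
    · simp only [submatrix_apply]
      rw [Equiv.sum_comp s (fun j => X (s i) j)]; exact h1 _
    · simp only [submatrix_apply]
      rw [Equiv.sum_comp s (fun i => X i (s j))]; exact h2 _
    · funext i
      have e : (((permQB s⁻¹ * r * permQB s⁻¹⁻¹) v : QB B) : B → ZMod 2) i
          = ((r (permQB s⁻¹⁻¹ v) : QB B) : B → ZMod 2) (s i) := rfl
      rw [e, h3]
      simp only [mulVec, dotProduct, submatrix_apply]
      rw [← Equiv.sum_comp s]
      refine Finset.sum_congr rfl fun j _ => ?_
      congr 1
      show (v : B → ZMod 2) (s⁻¹ (s j)) = _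
      simp
  one := by
    refine ⟨Em_row hodd, fun j => ?_, 1, R.one_mem, fun v => ?_⟩
    · simp only [Em_symm _ j]; exact Em_row hodd j
    · rw [Em_apply _ ((mem_QB_iff _).1 v.2)]; rfl
  row := fun X h => h.1
  col := fun X h => h.2.1

/-- Every endomorphism has a matrix with even rows and columns. -/
theorem exists_matrix {B : Type*} [Fintype B] [DecidableEq B]
    (hodd : Odd (Fintype.card B)) (r : Module.End (ZMod 2) (QB B)) :
    ∃ X : Matrix B B (ZMod 2), (∀ i, ∑ j, X i j = 0) ∧ (∀ j, ∑ i, X i j = 0) ∧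
      ∀ v : QB B, ((r v : QB B) : B → ZMod 2) = X.mulVec (v : B → ZMod 2) := by
  have hcard := odd_cast _ hodd
  let p : (B → ZMod 2) →ₗ[ZMod 2] (B → ZMod 2) :=
    { toFun := fun v i => v i + ∑ j, v j
      map_add' := fun v w => by
        funext i; simp only [Pi.add_apply, Finset.sum_add_distrib]; ring
      map_smul' := fun c v => by
        funext i; simp only [Pi.smul_apply, smul_eq_mul, ← Finset.mul_sum, RingHom.id_apply]; ring }
  have hp : ∀ v, p v ∈ QB B := by
    intro v
    rw [mem_QB_iff]
    show ∑ i, (v i + ∑ j, v j) = 0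
    rw [Finset.sum_add_distrib]
    simp only [Finset.sum_const, Finset.card_univ, nsmul_eq_mul, hcard]
    grind
  let f : (B → ZMod 2) →ₗ[ZMod 2] (B → ZMod 2) := (QB B).subtype ∘ₗ r ∘ₗ (p.codRestrict (QB B) hp)
  have hf : ∀ v, (LinearMap.toMatrix' f).mulVec v = f v := fun v => by
    rw [← Matrix.toLin'_apply, Matrix.toLin'_toMatrix']
  refine ⟨LinearMap.toMatrix' f, fun i => ?_, fun j => ?_, fun v => ?_⟩
  · have h1 := congrFun (hf 1) i
    have h2 : p 1 = 0 := by
      funext i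
      show (1 : ZMod 2) + ∑ j : B, (1 : ZMod 2) = 0
      simp only [Finset.sum_const, Finset.card_univ, nsmul_eq_mul, hcard]
      decide
    have h3 : p.codRestrict (QB B) hp 1 = 0 := Subtype.ext h2
    have h4 : f 1 = 0 := by
      simp only [f, LinearMap.comp_apply, h3, map_zero]
    rw [h4] at h1
    simpa [mulVec, dotProduct] using h1
  · simp only [LinearMap.toMatrix'_apply]
    exact (mem_QB_iff _).1 (r (p.codRestrict (QB B) hp _)).2
  · rw [hf]
    have h3 : p.codRestrict (QB B) hp v = v := by
      apply Subtype.ext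
      funext i
      show (v : B → ZMod 2) i + ∑ j, (v : B → ZMod 2) j = _
      rw [(mem_QB_iff _).1 v.2, add_zero]
    simp only [f, LinearMap.comp_apply, h3]
    rfl

theorem expand {B : Type*} [Fintype B] [DecidableEq B] (X : Matrix B B (ZMod 2))
    (h1 : ∀ i, ∑ j, X i j = 0) (h2 : ∀ j, ∑ i, X i j = 0) (o : B) :
    X = ∑ i ∈ Finset.univ.erase o, ∑ j ∈ Finset.univ.erase o,
      X i j • vecMulVec (dd i o) (dd j o) := by
  have h1' : ∀ i, ∑ j ∈ Finset.univ.erase o, X i j = X i o := by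
    intro i
    have := Finset.add_sum_erase Finset.univ (fun j => X i j) (Finset.mem_univ o)
    rw [h1] at this
    grind
  have h2' : ∀ j, ∑ i ∈ Finset.univ.erase o, X i j = X o j := by
    intro j
    have := Finset.add_sum_erase Finset.univ (fun i => X i j) (Finset.mem_univ o)
    rw [h2] at this
    grind
  have hd : ∀ (f : B → ZMod 2) (p : B),
      ∑ j ∈ Finset.univ.erase o, f j * dd j o p =
        if p = o then ∑ j ∈ Finset.univ.erase o, f j else f p := by
    intro f p
    by_cases hp : p = o
    · simp [dd, hp]
    · simp [dd, hp]
  ext p q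
  simp only [Matrix.sum_apply, Matrix.smul_apply, vecMulVec_apply, smul_eq_mul]
  have e : ∀ i j, X i j * (dd i o p * dd j o q) = dd i o p * (X i j * dd j o q) := by
    intros; ring
  simp only [e, ← Finset.mul_sum, hd]
  have e' : ∀ i, (if q = o then ∑ j ∈ Finset.univ.erase o, X i j else X i q) = X i q := by
    intro i
    split_ifs with h
    · rw [h1', h]
    · rfl
  simp only [e', mul_comm (dd _ o p), hd]
  split_ifs with h
  · rw [h2', h]
  · rfl

theorem sum_mem_S {B ι : Type*} [Fintype B] [DecidableEq B] {S : Set (Matrix B B (ZMod 2))}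
    (hS : Good S) (t : Finset ι) (f : ι → Matrix B B (ZMod 2)) (hf : ∀ i ∈ t, f i ∈ S) :
    ∑ i ∈ t, f i ∈ S := by
  refine Finset.sum_induction f (· ∈ S) (fun a b ha hb => hS.add a ha b hb) ?_ hf
  have := hS.add _ hS.one _ hS.one
  have h : Em B + Em B = 0 := by
    ext i j
    simp only [Matrix.add_apply, Matrix.zero_apply]
    grind
  rwa [h] at this


/-- For `|B| = n` odd, `n ≥ 5`: if `R` is a unital `F₂`-subalgebra of
`End_{F₂}(Q_B)` with `u R u⁻¹ ⊆ R` for every `u` in the alternating group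
`Alt(B)`, then `R = F₂·Id` or `R = End_{F₂}(Q_B)`. -/
theorem subalgebra_conj_alternating (B : Type*) [Fintype B] [DecidableEq B]
    (hodd : Odd (Fintype.card B)) (h5 : 5 ≤ Fintype.card B)
    (R : Subalgebra (ZMod 2) (Module.End (ZMod 2) (QB B)))
    (hconj : ∀ s ∈ alternatingGroup B, ∀ r ∈ R,
      permQB s * r * permQB s⁻¹ ∈ R) :
    R = ⊥ ∨ R = ⊤ := by
  have hS := good_SR hodd R hconj
  have cases3 : ∀ X ∈ SR R, X = 0 ∨ X = Em B ∨ Full (SR R) := by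
    intro X hX
    by_cases h : Fintype.card B = 5
    · exact small hS h X hX
    · refine big hS hodd ?_ X hX
      obtain ⟨k, hk⟩ := hodd
      omega
  by_cases hF : Full (SR R)
  · right
    rw [eq_top_iff]
    intro r _
    obtain ⟨X, h1, h2, h3⟩ := exists_matrix hodd r
    obtain ⟨o⟩ : Nonempty B := Fintype.card_pos_iff.1 (by omega)
    have hX : X ∈ SR R := by
      rw [expand X h1 h2 o]
      refine sum_mem_S hS _ _ fun i hi => sum_mem_S hS _ _ fun j hj => ?_
      rcases z2 (X i j) with h | h
      · rw [h, zero_smul]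
        simpa using sum_mem_S hS (∅ : Finset B) (fun _ => 0) (by simp)
      · rw [h, one_smul]
        exact hF i o j (Finset.ne_of_mem_erase hi) (Finset.ne_of_mem_erase hj)
    obtain ⟨_, _, r', hr', h3'⟩ := hX
    have : r = r' := by
      apply LinearMap.ext
      intro v
      apply Subtype.ext
      rw [h3, h3']
    rw [this]
    exact hr'
  · left
    rw [eq_bot_iff]
    intro r hr
    obtain ⟨X, h1, h2, h3⟩ := exists_matrix hodd r
    rcases cases3 X ⟨h1, h2, r, hr, h3⟩ with h | h | h
    · have : r = 0 := by
        apply LinearMap.ext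
        intro v
        apply Subtype.ext
        rw [h3, h, zero_mulVec]
        rfl
      rw [this]
      exact Subalgebra.zero_mem _
    · have : r = 1 := by
        apply LinearMap.ext
        intro v
        apply Subtype.ext
        rw [h3, h, Em_apply _ ((mem_QB_iff _).1 v.2)]
        rfl
      rw [this]
      exact Subalgebra.one_mem _
    · exact absurd h hF
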